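/- Let T : ℂ² → ℂ² be the linear map T(a,b) = (a·e^{iθ} + b·e^{-iθ}, a·e^{iφ} + b·e^{-iφ}) for real numbers θ, φ. Then T is invertible if and only if sin(θ - φ) ≠ 0, and in that case the operator norm of T⁻¹ (with respect to the standard Euclidean norm on ℂ²) equals √(1 + |cos(θ - φ)|)/(√2·|sin(θ - φ)|). -/

import Mathlib

theorem sin_sub_sq_mul_eq (θ φ p q : ℝ) :
    Real.sin (θ - φ) ^ 2 * (p ^ 2 + q ^ 2) =
      (p * Real.cos θ + q * Real.sin θ) ^ 2 + (p * Real.cos φ + q * Real.sin φ) ^ 2 -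
        2 * Real.cos (θ - φ) *
          ((p * Real.cos θ + q * Real.sin θ) * (p * Real.cos φ + q * Real.sin φ)) := by
  rw [Real.sin_sub, Real.cos_sub]
  linear_combination
    (p * Real.cos θ + q * Real.sin θ) ^ 2 * Real.sin_sq_add_cos_sq φ +
      (p * Real.cos φ + q * Real.sin φ) ^ 2 * Real.sin_sq_add_cos_sq θ

theorem euclideanSpace_fin_two_norm_sq (v : EuclideanSpace ℂ (Fin 2)) :
    ‖v‖ ^ 2 = (v 0).re ^ 2 + (v 0).im ^ 2 + ((v 1).re ^ 2 + (v 1).im ^ 2) := by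
  simp only [EuclideanSpace.norm_sq_eq, Fin.sum_univ_two, Complex.sq_norm, Complex.normSq_apply]
  ring

theorem two_mul_sin_sub_sq_mul_norm_sq (θ φ : ℝ) (v w : EuclideanSpace ℂ (Fin 2))
    (h₀ : w 0 = v 0 * Complex.exp (Complex.I * θ) + v 1 * Complex.exp (-(Complex.I * θ)))
    (h₁ : w 1 = v 0 * Complex.exp (Complex.I * φ) + v 1 * Complex.exp (-(Complex.I * φ))) :
    2 * Real.sin (θ - φ) ^ 2 * ‖v‖ ^ 2 = ‖w‖ ^ 2 - 2 * Real.cos (θ - φ) *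
      ((w 0).re * (w 1).re + (w 0).im * (w 1).im) := by
  rw [euclideanSpace_fin_two_norm_sq, euclideanSpace_fin_two_norm_sq, h₀, h₁]
  simp only [Complex.add_re, Complex.add_im, Complex.mul_re, Complex.mul_im, Complex.exp_re,
    Complex.exp_im, Complex.neg_re, Complex.neg_im, Complex.I_re, Complex.I_im,
    Complex.ofReal_re, Complex.ofReal_im, zero_mul, one_mul, mul_zero, sub_zero, zero_add,
    neg_zero, Real.exp_zero, Real.cos_neg, Real.sin_neg]
  linear_combination
    sin_sub_sq_mul_eq θ φ ((v 0).re + (v 1).re) ((v 1).im - (v 0).im) +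
      sin_sub_sq_mul_eq θ φ ((v 0).im + (v 1).im) ((v 0).re - (v 1).re)


open Complex in
theorem stmt_12 (θ φ : ℝ)
    (T : EuclideanSpace ℂ (Fin 2) →L[ℂ] EuclideanSpace ℂ (Fin 2))
    (hT : ∀ v : EuclideanSpace ℂ (Fin 2),
      T v 0 = v 0 * Complex.exp (I * θ) + v 1 * Complex.exp (-(I * θ)) ∧
      T v 1 = v 0 * Complex.exp (I * φ) + v 1 * Complex.exp (-(I * φ))) :
    ((∃ S : EuclideanSpace ℂ (Fin 2) →L[ℂ] EuclideanSpace ℂ (Fin 2),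
        S.comp T = ContinuousLinearMap.id ℂ _ ∧ T.comp S = ContinuousLinearMap.id ℂ _) ↔
      Real.sin (θ - φ) ≠ 0) ∧
    (∀ S : EuclideanSpace ℂ (Fin 2) →L[ℂ] EuclideanSpace ℂ (Fin 2),
      S.comp T = ContinuousLinearMap.id ℂ _ → T.comp S = ContinuousLinearMap.id ℂ _ →
      ‖S‖ = Real.sqrt (1 + |Real.cos (θ - φ)|) /
        (Real.sqrt 2 * |Real.sin (θ - φ)|)) := by
  have key (v) := two_mul_sin_sub_sq_mul_norm_sq θ φ v (T v) (hT v).1 (hT v).2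
  have right_inv {S : EuclideanSpace ℂ (Fin 2) →L[ℂ] EuclideanSpace ℂ (Fin 2)}
      (hS : T.comp S = ContinuousLinearMap.id ℂ _) (w) : T (S w) = w :=
    DFunLike.congr_fun hS w
  have hinv : (∃ S : EuclideanSpace ℂ (Fin 2) →L[ℂ] EuclideanSpace ℂ (Fin 2),
      S.comp T = ContinuousLinearMap.id ℂ _ ∧ T.comp S = ContinuousLinearMap.id ℂ _) ↔
      Real.sin (θ - φ) ≠ 0 := by
    constructor
    · rintro ⟨S, -, hS⟩ hs
      have h := key (S !₂[1, 0])
      rw [right_inv hS, euclideanSpace_fin_two_norm_sq !₂[1, 0], hs] at h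
      simp at h
    · intro hs
      have hinj : Function.Injective T := by
        refine (injective_iff_map_eq_zero T).2 fun v hv => ?_
        have h := key v
        rw [hv] at h
        simpa [hs] using h
      let e := (LinearEquiv.ofInjectiveEndo T.toLinearMap hinj).toContinuousLinearEquiv
      have he (v) : e v = T v := rfl
      refine ⟨e.symm, ?_, ?_⟩
      · ext1 v
        simp [← he]
      · ext1 v
        simp [← he]
  refine ⟨hinv, fun S hST hTS => ?_⟩
  have hs : Real.sin (θ - φ) ≠ 0 := hinv.1 ⟨S, hST, hTS⟩
  have keyS (w) := key (S w)
  simp only [right_inv hTS] at keyS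
  set K := √(1 + |Real.cos (θ - φ)|) / (√2 * |Real.sin (θ - φ)|) with hK
  have hK0 : 0 ≤ K := by positivity
  have hK2 : 2 * Real.sin (θ - φ) ^ 2 * K ^ 2 = 1 + |Real.cos (θ - φ)| := by
    rw [hK, div_pow, mul_pow, Real.sq_sqrt (by positivity), Real.sq_sqrt (by positivity), sq_abs]
    field_simp
  have hs2 : 0 < 2 * Real.sin (θ - φ) ^ 2 := by positivity
  apply le_antisymm
  · refine S.opNorm_le_bound hK0 fun w => ?_
    refine (sq_le_sq₀ (by positivity) (by positivity)).1 ?_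
    refine le_of_mul_le_mul_left ?_ hs2
    rw [mul_pow, ← mul_assoc, hK2, keyS, euclideanSpace_fin_two_norm_sq]
    rcases abs_cases (Real.cos (θ - φ)) with ⟨h, hc⟩ | ⟨h, hc⟩ <;> rw [h]
    · nlinarith [mul_nonneg hc (add_nonneg (sq_nonneg ((w 0).re + (w 1).re))
        (sq_nonneg ((w 0).im + (w 1).im)))]
    · nlinarith [mul_nonneg (neg_nonneg.2 hc.le) (add_nonneg (sq_nonneg ((w 0).re - (w 1).re))
        (sq_nonneg ((w 0).im - (w 1).im)))]
  · obtain ⟨w, hw, hSw⟩ : ∃ w : EuclideanSpace ℂ (Fin 2), 0 < ‖w‖ ∧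
        2 * Real.sin (θ - φ) ^ 2 * ‖S w‖ ^ 2 = (1 + |Real.cos (θ - φ)|) * ‖w‖ ^ 2 := by
      have hpos {w : EuclideanSpace ℂ (Fin 2)} (h : w 0 = 1) : 0 < ‖w‖ :=
        norm_pos_iff.2 fun h0 => by simp [h0] at h
      rcases abs_cases (Real.cos (θ - φ)) with ⟨h, -⟩ | ⟨h, -⟩
      · refine ⟨!₂[1, -1], hpos (by simp), ?_⟩
        rw [keyS, h, euclideanSpace_fin_two_norm_sq]
        simp
        ring
      · refine ⟨!₂[1, 1], hpos (by simp), ?_⟩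
        rw [keyS, h, euclideanSpace_fin_two_norm_sq]
        simp
        ring
    refine le_of_mul_le_mul_right (le_trans (le_of_eq ?_) (S.le_opNorm w)) hw
    refine (sq_eq_sq₀ (by positivity) (by positivity)).1 ?_
    refine mul_left_cancel₀ hs2.ne' ?_
    rw [hSw, mul_pow, ← mul_assoc, hK2]
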